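/- arXiv:math/0411293 — 2 statements merged into one kernel-verified Lean document; each statement's English description precedes it below -/
import Mathlib

section
/- Let f be a strictly convex norm on ℝ^n. Then for every ε > 0 there exists δ > 0 such that: for every θ ∈ ℝ^n with f(θ) = 1 and every ξ ∈ ℝ^n with f(ξ) ≤ 1 and f(ξ − θ) > 1, if the normalized point Ξ(ξ) = ξ / f(ξ) satisfies f(Ξ(ξ) − θ) ≤ 1 + δ (i.e., Ξ(ξ) lies on the unit sphere of f, outside B_f^1(θ) but inside B_f^{1+δ}(θ)), then f(ξ) > 1 − ε. -/
open scoped BigOperators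

/-- `f` is a (symmetric convex gauge) norm on `ℝ^n`. -/
structure IsGaugeNorm {n : ℕ} (f : (Fin n → ℝ) → ℝ) : Prop where
  continuous : Continuous f
  nonneg : ∀ x, 0 ≤ f x
  eq_zero_iff : ∀ x, f x = 0 ↔ x = 0
  neg : ∀ x, f (-x) = f x
  smul : ∀ t : ℝ, 0 ≤ t → ∀ x, f (t • x) = t * f x
  add_le : ∀ x y, f (x + y) ≤ f x + f y

/-- The remainder vector `ξ = p·α − a`. -/
noncomputable def xiv {n : ℕ} (α : Fin n → ℝ) (p : ℤ) (a : Fin n → ℤ) : Fin n → ℝ :=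
  fun j => (p : ℝ) * α j - (a j : ℝ)

/-- `(p, a)` with `p ≥ 1` is an `f`-best simultaneous approximation to `α`. -/
def IsFBSA {n : ℕ} (f : (Fin n → ℝ) → ℝ) (α : Fin n → ℝ) (p : ℤ) (a : Fin n → ℤ) : Prop :=
  1 ≤ p ∧
  (∀ (q : ℤ) (b : Fin n → ℤ), 1 ≤ q → q ≤ p - 1 → f (xiv α p a) < f (xiv α q b)) ∧
  (∀ b : Fin n → ℤ, b ≠ a → f (xiv α p a) < f (xiv α p b))

/-- `τ : ℕ → ℤ × ℤ^n` is the (exhaustive) sequence of all `f`-b.s.a. to `α`,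
with strictly increasing `p_ν`. -/
def IsFBSASeq {n : ℕ} (f : (Fin n → ℝ) → ℝ) (α : Fin n → ℝ)
    (τ : ℕ → ℤ × (Fin n → ℤ)) : Prop :=
  (∀ ν : ℕ, IsFBSA f α (τ ν).1 (τ ν).2) ∧
  (∀ ν : ℕ, (τ ν).1 < (τ (ν + 1)).1) ∧
  (∀ (p : ℤ) (a : Fin n → ℤ), IsFBSA f α p a → ∃ ν : ℕ, τ ν = (p, a))

/-- The normalized remainder `Ξ_ν = ξ_ν / f(ξ_ν)`. -/
noncomputable def Xiv {n : ℕ} (f : (Fin n → ℝ) → ℝ) (α : Fin n → ℝ)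
    (τ : ℕ → ℤ × (Fin n → ℤ)) (ν : ℕ) : Fin n → ℝ :=
  (f (xiv α (τ ν).1 (τ ν).2))⁻¹ • xiv α (τ ν).1 (τ ν).2

/-- `f` is strictly convex: the boundary of its unit ball contains no line segment. -/
def StrictlyConvexNorm {n : ℕ} (f : (Fin n → ℝ) → ℝ) : Prop :=
  ∀ x y : Fin n → ℝ, f x = 1 → f y = 1 → x ≠ y →
    ∀ t : ℝ, t ∈ Set.Ioo (0 : ℝ) 1 → f (t • x + (1 - t) • y) < 1

namespace IsGaugeNorm

variable {n : ℕ} {f : (Fin n → ℝ) → ℝ}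

/-- A norm on `ℝ^n` dominates a positive multiple of the sup norm. -/
theorem exists_pos_mul_norm_le (hf : IsGaugeNorm f) :
    ∃ c : ℝ, 0 < c ∧ ∀ x, c * ‖x‖ ≤ f x := by
  have hpos : ∀ x ∈ Metric.sphere (0 : Fin n → ℝ) 1, 0 < f x := by
    intro x hx
    refine lt_of_le_of_ne (hf.nonneg x) fun h => ?_
    rw [(hf.eq_zero_iff x).1 h.symm] at hx
    simp at hx
  obtain ⟨c, hc, hcf⟩ :=
    (isCompact_sphere (0 : Fin n → ℝ) 1).exists_forall_le' hf.continuous.continuousOn hpos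
  refine ⟨c, hc, fun x => ?_⟩
  rcases eq_or_ne x 0 with rfl | hx
  · simpa using hf.nonneg 0
  have hx' : 0 < ‖x‖ := norm_pos_iff.2 hx
  have h := hcf (‖x‖⁻¹ • x) (by simp [norm_smul, hx'.ne'])
  rwa [hf.smul _ (inv_nonneg.2 hx'.le), inv_mul_eq_div, le_div_iff₀ hx'] at h

/-- The unit sphere of a norm on `ℝ^n` is compact. -/
theorem isCompact_unitSphere (hf : IsGaugeNorm f) : IsCompact {x | f x = 1} := by
  obtain ⟨c, hc, hcf⟩ := hf.exists_pos_mul_norm_le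
  refine (isCompact_closedBall (0 : Fin n → ℝ) (1 / c)).of_isClosed_subset
    (isClosed_eq hf.continuous continuous_const) fun x hx => ?_
  have h := hcf x
  rw [Set.mem_ofPred_eq] at hx
  rw [mem_closedBall_zero_iff, le_div_iff₀ hc]
  linarith

theorem convex_combination_le (hf : IsGaugeNorm f) {t : ℝ} (h0 : 0 ≤ t) (h1 : t ≤ 1)
    (x y : Fin n → ℝ) : f (t • x + (1 - t) • y) ≤ t * f x + (1 - t) * f y := by
  have h := hf.add_le (t • x) ((1 - t) • y)
  rwa [hf.smul t h0, hf.smul (1 - t) (by linarith)] at h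

/-- If `θ` and `η` are unit vectors of a strictly convex norm and some `r • η` with `0 < r < 1`
has distance at least one from `θ`, then `η` has distance greater than one from `θ`. -/
theorem one_lt_sub_of_one_le_smul_sub (hf : IsGaugeNorm f) (hsc : StrictlyConvexNorm f)
    {r : ℝ} (hr : r ∈ Set.Ioo (0 : ℝ) 1) {θ η : Fin n → ℝ} (hθ : f θ = 1) (hη : f η = 1)
    (h : 1 ≤ f (r • η - θ)) : 1 < f (η - θ) := by
  have hθ' : f (-θ) = 1 := by rw [hf.neg, hθ]
  have heq : r • η - θ = r • (η - θ) + (1 - r) • (-θ) := by module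
  rw [heq] at h
  by_contra! hle
  rcases hle.lt_or_eq with hlt | hone
  · have hc := hf.convex_combination_le hr.1.le hr.2.le (η - θ) (-θ)
    rw [hθ'] at hc
    nlinarith [hr.1]
  · refine (hsc (η - θ) (-θ) hone hθ' (fun he => ?_) r hr).not_ge h
    have h0 : η = 0 := by simpa [sub_eq_add_neg] using he
    rw [(hf.eq_zero_iff η).2 h0] at hη
    exact zero_ne_one hη

/-- Along a ray from the origin, the distance to a unit vector `θ` stays at least one once it has
exceeded one. -/
theorem one_le_smul_sub_of_one_lt_smul_sub (hf : IsGaugeNorm f) {s r : ℝ} (hs : 0 < s)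
    (hsr : s ≤ r) {θ η : Fin n → ℝ} (hθ : f θ = 1) (h : 1 < f (s • η - θ)) :
    1 ≤ f (r • η - θ) := by
  have hr : 0 < r := hs.trans_le hsr
  have heq : s • η - θ = (s / r) • (r • η - θ) + (1 - s / r) • (-θ) := by
    have hm : s / r * r = s := div_mul_cancel₀ s hr.ne'
    rw [smul_sub, smul_smul, hm]
    module
  have hc := hf.convex_combination_le (div_pos hs hr).le ((div_le_one hr).2 hsr)
    (r • η - θ) (-θ)
  rw [← heq, hf.neg, hθ] at hc
  nlinarith [div_pos hs hr]

/-- Uniform version of `one_lt_sub_of_one_le_smul_sub`. -/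
theorem exists_one_lt_forall_le_sub (hf : IsGaugeNorm f) (hsc : StrictlyConvexNorm f)
    {r : ℝ} (hr : r ∈ Set.Ioo (0 : ℝ) 1) :
    ∃ m : ℝ, 1 < m ∧ ∀ θ η : Fin n → ℝ, f θ = 1 → f η = 1 → 1 ≤ f (r • η - θ) →
      m ≤ f (η - θ) := by
  have hcont := hf.continuous
  have hK : IsCompact (({x | f x = 1} ×ˢ {x | f x = 1}) ∩
      {p : (Fin n → ℝ) × (Fin n → ℝ) | 1 ≤ f (r • p.2 - p.1)}) :=
    (hf.isCompact_unitSphere.prod hf.isCompact_unitSphere).inter_right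
      (isClosed_le continuous_const (by fun_prop))
  obtain ⟨m, hm, hmf⟩ := hK.exists_forall_le' (f := fun p => f (p.2 - p.1)) (a := 1)
    (by fun_prop) fun p hp => by
      simp only [Set.mem_inter_iff, Set.mem_prod, Set.mem_ofPred_eq] at hp
      exact hf.one_lt_sub_of_one_le_smul_sub hsc hr hp.1.1 hp.1.2 hp.2
  refine ⟨m, hm, fun θ η hθ hη h => hmf (θ, η) ?_⟩
  simp only [Set.mem_inter_iff, Set.mem_prod, Set.mem_ofPred_eq]
  exact ⟨⟨hθ, hη⟩, h⟩

end IsGaugeNorm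

/-- For a strictly convex norm `f`: for every `ε > 0` there is
`δ > 0` such that whenever `f(θ) = 1`, `f(ξ) ≤ 1`, `f(ξ − θ) > 1` and the normalization
`Ξ(ξ) = ξ / f(ξ)` satisfies `f(Ξ(ξ) − θ) ≤ 1 + δ`, one has `f(ξ) > 1 − ε`. -/
theorem stmt15 (n : ℕ) (f : (Fin n → ℝ) → ℝ) (hf : IsGaugeNorm f)
    (hsc : StrictlyConvexNorm f) :
    ∀ ε : ℝ, 0 < ε → ∃ δ : ℝ, 0 < δ ∧
      ∀ θ ξ : Fin n → ℝ, f θ = 1 → f ξ ≤ 1 → 1 < f (ξ - θ) →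
        f ((f ξ)⁻¹ • ξ - θ) ≤ 1 + δ → 1 - ε < f ξ := by
  intro ε hε
  have hr : max (1 - ε) (1 / 2) ∈ Set.Ioo (0 : ℝ) 1 :=
    ⟨lt_max_of_lt_right (by norm_num), max_lt (by linarith) (by norm_num)⟩
  obtain ⟨m, hm, hmf⟩ := hf.exists_one_lt_forall_le_sub hsc hr
  refine ⟨(m - 1) / 2, by linarith, fun θ ξ hθ _ hξθ hδ => ?_⟩
  by_contra! hle
  have hs : 0 < f ξ := by
    refine lt_of_le_of_ne (hf.nonneg ξ) fun h => ?_
    rw [(hf.eq_zero_iff ξ).1 h.symm, zero_sub, hf.neg, hθ] at hξθ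
    exact lt_irrefl _ hξθ
  have hη : f ((f ξ)⁻¹ • ξ) = 1 := by
    rw [hf.smul _ (inv_nonneg.2 hs.le), inv_mul_cancel₀ hs.ne']
  have hray := hf.one_le_smul_sub_of_one_lt_smul_sub hs (hle.trans (le_max_left _ (1 / 2)))
    (η := (f ξ)⁻¹ • ξ) hθ (by rwa [smul_inv_smul₀ hs.ne'])
  linarith [hmf θ _ hθ hη hray]
end

section
/- Let f be a norm on ℝ^n and let A ⊆ B_f^1 be f-asymptotically admissible. Then there exists a vector α = (α₁,…,α_n) ∈ ℝ^n with 1, α₁, …, α_n linearly independent over ℚ such that A = Γ_f(α), i.e., A is exactly the set of asymptotic directions of the f-b.s.a. sequence of α. -/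
open scoped BigOperators

/-- The set of limit points (along subsequences) of a sequence in `ℝ^n`. -/
def LimitPoints {n : ℕ} (u : ℕ → Fin n → ℝ) : Set (Fin n → ℝ) :=
  {x | ∃ φ : ℕ → ℕ, StrictMono φ ∧ Filter.Tendsto (u ∘ φ) Filter.atTop (nhds x)}

/-- `A ⊆ B_f^1` is `f`-asymptotically admissible: there is a sequence `θ_j` of points of
`A` such that for each `j` the point `0 ∈ ∂B_f^1(θ_j)` is illuminated from `θ_{j+1}`, and
the set of limit points of `(θ_j)` is exactly `A`. -/
def AsympAdmissible {n : ℕ} (f : (Fin n → ℝ) → ℝ) (A : Set (Fin n → ℝ)) : Prop :=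
  ∃ θ : ℕ → Fin n → ℝ, (∀ j : ℕ, θ j ∈ A) ∧
    (∀ j : ℕ, f (θ j) = 1 ∧ 1 < f (θ (j + 1) - θ j) ∧
      ∃ lam : ℝ, 0 < lam ∧ f (-(lam • θ (j + 1)) - θ j) < 1) ∧
    LimitPoints θ = A

namespace IsGaugeNorm

variable {n : ℕ} {f : (Fin n → ℝ) → ℝ}

lemma map_zero (hf : IsGaugeNorm f) : f 0 = 0 := (hf.eq_zero_iff 0).2 rfl

lemma pos (hf : IsGaugeNorm f) {x : Fin n → ℝ} (hx : x ≠ 0) : 0 < f x :=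
  (hf.nonneg x).lt_of_ne fun h => hx ((hf.eq_zero_iff x).1 h.symm)

lemma le_add_add (hf : IsGaugeNorm f) (x y : Fin n → ℝ) : f x ≤ f (x + y) + f y := by
  have h := hf.add_le (x + y) (-y)
  rwa [add_neg_cancel_right, hf.neg] at h

lemma exists_mul_norm_le (hf : IsGaugeNorm f) : ∃ κ > 0, ∀ x, κ * ‖x‖ ≤ f x := by
  obtain ⟨κ, hκ, h⟩ := (isCompact_sphere (0 : Fin n → ℝ) 1).exists_forall_le'
    hf.continuous.continuousOn (a := 0) fun x hx =>
      hf.pos fun h0 => by simp [h0] at hx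
  refine ⟨κ, hκ, fun x => ?_⟩
  rcases eq_or_ne x 0 with rfl | hx
  · simp [hf.map_zero]
  have hn : 0 < ‖x‖ := norm_pos_iff.2 hx
  have h1 := h (‖x‖⁻¹ • x) (by simp [norm_smul, hn.ne'])
  rw [hf.smul _ (by positivity)] at h1
  calc κ * ‖x‖ ≤ (‖x‖⁻¹ * f x) * ‖x‖ := by gcongr
    _ = f x := by field_simp

/-- If `f` decreases from `x` to `x + s • y`, then it decreases on the way. -/
lemma add_lt_of_add_smul_lt (hf : IsGaugeNorm f) {x y : Fin n → ℝ} {s : ℝ} (hs : 1 ≤ s)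
    (h : f (x + s • y) < f x) : f (x + y) < f x := by
  have hs0 : 0 < s := by linarith
  have e : x + y = (1 - s⁻¹) • x + s⁻¹ • (x + s • y) := by
    rw [smul_add, smul_smul, inv_mul_cancel₀ hs0.ne', ← add_assoc, ← add_smul]
    simp
  have h1 : 0 ≤ 1 - s⁻¹ := sub_nonneg.2 (inv_le_one_of_one_le₀ hs)
  have h2 := hf.add_le ((1 - s⁻¹) • x) (s⁻¹ • (x + s • y))
  rw [← e, hf.smul _ h1, hf.smul _ (by positivity)] at h2
  have h3 : s⁻¹ * f (x + s • y) < s⁻¹ * f x := by gcongr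
  linarith

/-- If `f` decreases from `x` to `x + s • y`, then it does not decrease in direction `-y`. -/
lemma le_sub_smul_of_add_smul_lt (hf : IsGaugeNorm f) {x y : Fin n → ℝ} {s t : ℝ}
    (hs : 0 < s) (ht : 0 ≤ t) (h : f (x + s • y) < f x) : f x ≤ f (x - t • y) := by
  have e : (s + t) • x = t • (x + s • y) + s • (x - t • y) := by
    ext j; simp; ring
  have h2 := hf.add_le (t • (x + s • y)) (s • (x - t • y))
  rw [← e, hf.smul _ (by positivity), hf.smul _ ht, hf.smul _ hs.le] at h2
  have h3 : t * f (x + s • y) ≤ t * f x := by gcongr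
  nlinarith

end IsGaugeNorm

/-- The rational point `a / p`. -/
noncomputable def ratPoint {n : ℕ} (p : ℤ) (a : Fin n → ℤ) : Fin n → ℝ :=
  fun j => (a j : ℝ) / p

/-- `(p, a)` generates the group of integer points proportional to it. -/
def IsPrimitivePoint {n : ℕ} (p : ℤ) (a : Fin n → ℤ) : Prop :=
  ∀ (q : ℤ) (b : Fin n → ℤ), xiv (ratPoint p a) q b = 0 → ∃ m : ℤ, q = m * p

section Remainders

variable {n : ℕ}

lemma xiv_eq_smul_sub {p : ℤ} (hp : 1 ≤ p) (a : Fin n → ℤ) (α : Fin n → ℝ) :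
    xiv α p a = (p : ℝ) • (α - ratPoint p a) := by
  have : (p : ℝ) ≠ 0 := by exact_mod_cast (by omega : p ≠ 0)
  ext j; simp [xiv, ratPoint]; field_simp

lemma xiv_eq_add (α β : Fin n → ℝ) (q : ℤ) (b : Fin n → ℤ) :
    xiv α q b = xiv β q b + (q : ℝ) • (α - β) := by
  ext j; simp [xiv]; ring

lemma xiv_add (α : Fin n → ℝ) (p q : ℤ) (a b : Fin n → ℤ) :
    xiv α (p + q) (a + b) = xiv α p a + xiv α q b := by
  ext j; simp [xiv]; ring

lemma xiv_smul (α : Fin n → ℝ) (m p : ℤ) (a : Fin n → ℤ) :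
    xiv α (m * p) (m • a) = (m : ℝ) • xiv α p a := by
  ext j; simp [xiv]; ring

lemma xiv_ratPoint_self {p : ℤ} (hp : 1 ≤ p) (a : Fin n → ℤ) :
    xiv (ratPoint p a) p a = 0 := by
  simp [xiv_eq_smul_sub hp]

lemma IsPrimitivePoint.eq_smul {p : ℤ} {a : Fin n → ℤ} (h : IsPrimitivePoint p a)
    (hp : 1 ≤ p) {q : ℤ} {b : Fin n → ℤ} (h0 : xiv (ratPoint p a) q b = 0) :
    ∃ m : ℤ, q = m * p ∧ b = m • a := by
  obtain ⟨m, rfl⟩ := h q b h0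
  refine ⟨m, rfl, ?_⟩
  have hp0 : (p : ℝ) ≠ 0 := by exact_mod_cast (by omega : p ≠ 0)
  ext j
  have hj := congrFun h0 j
  simp only [xiv, ratPoint, Pi.zero_apply] at hj
  have : (b j : ℝ) = m * a j := by
    push_cast at hj
    field_simp at hj
    linarith
  simpa using (by exact_mod_cast this : b j = m * a j)

/-- Coordinates of remainders at `a / p` are integers divided by `p`. -/
lemma mul_xiv_ratPoint {p : ℤ} (hp : 1 ≤ p) (a : Fin n → ℤ) (q : ℤ) (b : Fin n → ℤ)
    (j : Fin n) : (p : ℝ) * xiv (ratPoint p a) q b j = ((q * a j - p * b j : ℤ) : ℝ) := by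
  have hp0 : (p : ℝ) ≠ 0 := by exact_mod_cast (by omega : p ≠ 0)
  simp only [xiv, ratPoint]
  push_cast
  field_simp

lemma exists_int_mem_cone {D : Set (Fin n → ℝ)} (hD : IsOpen D)
    (hcone : ∀ t : ℝ, 0 < t → ∀ x ∈ D, t • x ∈ D) (hne : D.Nonempty) :
    ∃ v : Fin n → ℤ, (fun j => (v j : ℝ)) ∈ D := by
  obtain ⟨u, hu⟩ := hne
  obtain ⟨r, hr, hball⟩ := Metric.isOpen_iff.1 hD u hu
  obtain ⟨N, hN⟩ := exists_nat_one_div_lt hr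
  have hN0 : (0 : ℝ) < N + 1 := by positivity
  refine ⟨fun j => ⌊((N : ℝ) + 1) * u j⌋, ?_⟩
  have key : (fun j => (⌊((N : ℝ) + 1) * u j⌋ : ℝ) / (N + 1)) ∈ D := by
    refine hball ((dist_pi_lt_iff hr).2 fun j => lt_of_le_of_lt ?_ hN)
    rw [Real.dist_eq, abs_le]
    have h1 := Int.floor_le (((N : ℝ) + 1) * u j)
    have h2 := Int.lt_floor_add_one (((N : ℝ) + 1) * u j)
    constructor
    · rw [← sub_nonneg]
      have : (⌊((N : ℝ) + 1) * u j⌋ : ℝ) / (N + 1) - u j - -(1 / (N + 1)) =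
        (⌊((N : ℝ) + 1) * u j⌋ + 1 - (N + 1) * u j) / (N + 1) := by field_simp; ring
      rw [this]
      exact div_nonneg (by linarith) hN0.le
    · have : (⌊((N : ℝ) + 1) * u j⌋ : ℝ) / (N + 1) ≤ u j := by
        rw [div_le_iff₀ hN0]; linarith
      have : 0 ≤ 1 / ((N : ℝ) + 1) := by positivity
      linarith
  have e : (fun j => (⌊((N : ℝ) + 1) * u j⌋ : ℝ)) =
      ((N : ℝ) + 1) • fun j => (⌊((N : ℝ) + 1) * u j⌋ : ℝ) / (N + 1) := by
    ext j
    simp only [Pi.smul_apply, smul_eq_mul]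
    field_simp
  exact e ▸ hcone _ hN0 _ key

/-- Every open cone contains `-l` for a primitive vector `l` of the lattice of
remainders at `a / p`. -/
lemma exists_primitive_remainder {p : ℤ} (hp : 1 ≤ p) (a : Fin n → ℤ)
    {D : Set (Fin n → ℝ)} (hD : IsOpen D)
    (hcone : ∀ t : ℝ, 0 < t → ∀ x ∈ D, t • x ∈ D) (hne : D.Nonempty) (h0 : 0 ∉ D) :
    ∃ (q₀ : ℤ) (b₀ : Fin n → ℤ), -xiv (ratPoint p a) q₀ b₀ ∈ D ∧
      ∀ (q : ℤ) (b : Fin n → ℤ) (t : ℝ),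
        xiv (ratPoint p a) q b = t • xiv (ratPoint p a) q₀ b₀ → ∃ m : ℤ, t = m := by
  obtain ⟨v, hv⟩ := exists_int_mem_cone hD hcone hne
  set w : Fin n → ℝ := fun j => (v j : ℝ) with hw
  have hw0 : w ≠ 0 := fun h => h0 (h ▸ hv)
  obtain ⟨i, hi⟩ := Function.ne_iff.1 hw0
  have hi : (v i : ℝ) ≠ 0 := hi
  let T : AddSubgroup ℝ :=
    { carrier := {t | ∃ (q : ℤ) (b : Fin n → ℤ), xiv (ratPoint p a) q b = t • w}
      zero_mem' := ⟨0, 0, by ext; simp [xiv]⟩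
      add_mem' := by
        rintro s t ⟨q, b, h⟩ ⟨q', b', h'⟩
        exact ⟨q + q', b + b', by rw [xiv_add, h, h', add_smul]⟩
      neg_mem' := by
        rintro s ⟨q, b, h⟩
        refine ⟨-1 * q, (-1 : ℤ) • b, by rw [xiv_smul, h]; simp⟩ }
  have hp0 : (0 : ℝ) < p := by exact_mod_cast (by omega : 0 < p)
  have hpv : 0 < (p : ℝ) * |(v i : ℝ)| := by positivity
  obtain ⟨g, hg⟩ := AddSubgroup.cyclic_of_isolated_zero (H := T) (inv_pos.2 hpv) (by
    rw [Set.disjoint_left]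
    rintro t ⟨q, b, h⟩ ⟨ht0, ht1⟩
    have h1 := mul_xiv_ratPoint hp a q b i
    rw [h] at h1
    have h2 : |(p : ℝ) * (t • w) i| < 1 := by
      simp only [hw, Pi.smul_apply, smul_eq_mul]
      rw [abs_mul, abs_mul, abs_of_pos hp0, abs_of_pos ht0]
      calc (p : ℝ) * (t * |(v i : ℝ)|) = t * (p * |(v i : ℝ)|) := by ring
        _ < ((p : ℝ) * |(v i : ℝ)|)⁻¹ * (p * |(v i : ℝ)|) := by gcongr
        _ = 1 := inv_mul_cancel₀ hpv.ne'
    have h3 : q * a i - p * b i = 0 := by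
      rw [h1] at h2
      exact Int.abs_lt_one_iff.1 (by exact_mod_cast h2)
    rw [h3] at h1
    simp [hw, hp0.ne', ht0.ne', hi] at h1)
  have h1T : (1 : ℝ) ∈ T := ⟨0, -v, by ext; simp [xiv, hw]⟩
  have hg0 : g ≠ 0 := by
    rintro rfl
    rw [hg, AddSubgroup.mem_closure_singleton] at h1T
    obtain ⟨k, hk⟩ := h1T
    simp at hk
  have hgT : -|g| ∈ T := by
    have hgm : g ∈ T := hg ▸ AddSubgroup.subset_closure rfl
    rcases abs_choice g with h | h <;> rw [h]
    · exact T.neg_mem hgm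
    · simpa using hgm
  obtain ⟨q₀, b₀, h⟩ := hgT
  refine ⟨q₀, b₀, ?_, fun q b t ht => ?_⟩
  · rw [h, neg_smul, neg_neg]
    exact hcone _ (abs_pos.2 hg0) _ hv
  · rw [h, smul_smul] at ht
    have : t * -|g| ∈ T := ⟨q, b, ht⟩
    rw [hg, AddSubgroup.mem_closure_singleton] at this
    obtain ⟨m, hm⟩ := this
    rw [zsmul_eq_mul] at hm
    rcases abs_choice g with h | h <;> rw [h] at hm
    · refine ⟨-m, ?_⟩
      push_cast
      apply mul_right_cancel₀ hg0
      linarith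
    · refine ⟨m, ?_⟩
      apply mul_right_cancel₀ hg0
      linarith

/-- Remainders other than `0` and `l` stay away from the segment `[0, l]` when `l` is
primitive. -/
lemma exists_gap {f : (Fin n → ℝ) → ℝ} (hf : IsGaugeNorm f) {p : ℤ} (hp : 1 ≤ p)
    (a : Fin n → ℤ) (l : Fin n → ℝ)
    (hl : ∀ (q : ℤ) (b : Fin n → ℤ) (t : ℝ),
      xiv (ratPoint p a) q b = t • l → ∃ m : ℤ, t = m) :
    ∃ δ > 0, ∀ (q : ℤ) (b : Fin n → ℤ), xiv (ratPoint p a) q b ≠ 0 →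
      xiv (ratPoint p a) q b ≠ l → ∀ s ∈ Set.Icc (0 : ℝ) 1,
        δ ≤ f (xiv (ratPoint p a) q b - s • l) := by
  have hp0 : (0 : ℝ) < p := by exact_mod_cast (by omega : 0 < p)
  let S : Set (Fin n → ℝ) := {z | z ≠ 0 ∧ z ≠ l ∧ ∃ q b, xiv (ratPoint p a) q b = z}
  have hS : IsClosed S := by
    refine Metric.isClosed_of_pairwise_le_dist (ε := (p : ℝ)⁻¹) (inv_pos.2 hp0) ?_
    rintro _ ⟨-, -, q, b, rfl⟩ _ ⟨-, -, q', b', rfl⟩ hne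
    obtain ⟨j, hj⟩ := Function.ne_iff.1 hne
    refine le_trans ?_ (dist_le_pi_dist _ _ j)
    rw [Real.dist_eq, inv_le_iff_one_le_mul₀' hp0]
    nth_rewrite 1 [← abs_of_pos hp0]
    rw [← abs_mul, mul_sub, mul_xiv_ratPoint hp, mul_xiv_ratPoint hp, ← Int.cast_sub,
      ← Int.cast_abs]
    have : (q * a j - p * b j) - (q' * a j - p * b' j) ≠ 0 := by
      intro h
      apply hj
      apply mul_left_cancel₀ hp0.ne'
      rw [mul_xiv_ratPoint hp, mul_xiv_ratPoint hp, sub_eq_zero.1 h]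
    exact_mod_cast Int.one_le_abs this
  have hK : IsCompact ((fun s : ℝ => s • l) '' Set.Icc 0 1) :=
    isCompact_Icc.image (by fun_prop)
  have hd : Disjoint ((fun s : ℝ => s • l) '' Set.Icc 0 1) S := by
    rw [Set.disjoint_left]
    rintro _ ⟨s, ⟨hs0, hs1⟩, rfl⟩ ⟨h0, h1, q, b, h⟩
    obtain ⟨m, rfl⟩ := hl q b s h
    have hm0 : 0 ≤ m := by exact_mod_cast hs0
    have hm1 : m ≤ 1 := by exact_mod_cast hs1
    obtain rfl | rfl : m = 0 ∨ m = 1 := by omega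
    · simp at h0
    · simp at h1
  obtain ⟨δ, hδ, hdis⟩ := hd.exists_thickenings hK hS
  obtain ⟨κ, hκ, hκf⟩ := hf.exists_mul_norm_le
  refine ⟨κ * δ, by positivity, fun q b h0 h1 s hs => le_trans ?_ (hκf _)⟩
  gcongr
  rw [← dist_eq_norm]
  by_contra! hlt
  exact Set.disjoint_left.1 hdis
    (Metric.mem_thickening_iff.2 ⟨s • l, ⟨s, hs, rfl⟩, hlt⟩)
    (Metric.self_subset_thickening hδ S ⟨h0, h1, q, b, rfl⟩)

end Remainders

open Filter Topology

section Step

variable {n : ℕ}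

/-- The affine form with integer coefficients `c` evaluated at `α`. -/
def affineForm (c : Fin (n + 1) → ℤ) (α : Fin n → ℝ) : ℝ :=
  (c 0 : ℝ) + ∑ j : Fin n, (c j.succ : ℝ) * α j

lemma continuous_affineForm (c : Fin (n + 1) → ℤ) : Continuous (affineForm c) := by
  unfold affineForm
  fun_prop

lemma affineForm_add_smul (c : Fin (n + 1) → ℤ) (α x : Fin n → ℝ) (s : ℝ) :
    affineForm c (α + s • x) = affineForm c α + s * ∑ j : Fin n, (c j.succ : ℝ) * x j := by
  simp only [affineForm, Pi.add_apply, Pi.smul_apply, smul_eq_mul, mul_add,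
    Finset.sum_add_distrib, Finset.mul_sum, add_assoc]
  congr 2
  exact Finset.sum_congr rfl fun j _ => by ring

/-- An open cone can be shrunk so as to avoid the direction of a given hyperplane. -/
lemma exists_subcone_avoiding (c : Fin n → ℤ) (hc : c ≠ 0) {D : Set (Fin n → ℝ)}
    (hD : IsOpen D) (hcone : ∀ t : ℝ, 0 < t → ∀ x ∈ D, t • x ∈ D) (hne : D.Nonempty) :
    ∃ D₁ ⊆ D, IsOpen D₁ ∧ (∀ t : ℝ, 0 < t → ∀ x ∈ D₁, t • x ∈ D₁) ∧ D₁.Nonempty ∧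
      ∀ x ∈ D₁, ∑ j : Fin n, (c j : ℝ) * x j ≠ 0 := by
  refine ⟨D ∩ {x | ∑ j : Fin n, (c j : ℝ) * x j ≠ 0}, Set.inter_subset_left,
    hD.inter (isOpen_ne_fun (by fun_prop) (by fun_prop)), ?_, ?_, fun x hx => hx.2⟩
  · rintro t ht x ⟨hx, hx'⟩
    refine ⟨hcone t ht x hx, ?_⟩
    have : ∑ j : Fin n, (c j : ℝ) * (t • x) j = t * ∑ j : Fin n, (c j : ℝ) * x j := by
      rw [Finset.mul_sum]
      exact Finset.sum_congr rfl fun j _ => by simp; ring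
    simp only [Set.mem_ofPred_eq, this]
    exact mul_ne_zero ht.ne' hx'
  · obtain ⟨u, hu⟩ := hne
    obtain ⟨i, hi⟩ := Function.ne_iff.1 hc
    have hi : (c i : ℝ) ≠ 0 := by exact_mod_cast hi
    by_cases h0 : ∑ j : Fin n, (c j : ℝ) * u j = 0
    · have ht : Tendsto (fun s : ℝ => u + s • (Pi.single i 1 : Fin n → ℝ)) (𝓝 0) (𝓝 u) := by
        have : Continuous fun s : ℝ => u + s • (Pi.single i 1 : Fin n → ℝ) := by fun_prop
        simpa using this.tendsto 0
      have h1 := (ht.eventually (hD.mem_nhds hu)).filter_mono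
        (nhdsWithin_le_nhds (s := Set.Ioi 0))
      obtain ⟨s, hs, hs0⟩ := (h1.and self_mem_nhdsWithin).exists
      refine ⟨_, hs, ?_⟩
      have : ∑ j : Fin n, (c j : ℝ) * (u + s • (Pi.single i 1 : Fin n → ℝ)) j = s * c i := by
        simp only [Pi.add_apply, mul_add, Finset.sum_add_distrib, h0]
        simp [Pi.single_apply, mul_comm]
      simp only [Set.mem_ofPred_eq, this]
      exact mul_ne_zero (ne_of_gt hs0) hi
    · exact ⟨u, hu, h0⟩

/-- If `α` lies beyond `a' / p'` in a direction illuminating the direction from `a / p` to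
`a' / p'`, then `(p', a')` follows `(p, a)` in the sequence of best approximations. -/
lemma consecutive_of_gap {f : (Fin n → ℝ) → ℝ} (hf : IsGaugeNorm f)
    {p p' : ℤ} {a a' : Fin n → ℤ} (hp : 1 ≤ p) (hp' : 1 ≤ p')
    (hprim : IsPrimitivePoint p a) {δ lam : ℝ} (hlam : 0 < lam)
    (hgap : ∀ (q : ℤ) (b : Fin n → ℤ), xiv (ratPoint p a) q b ≠ 0 →
      xiv (ratPoint p a) q b ≠ xiv (ratPoint p a) p' a' → ∀ s ∈ Set.Icc (0 : ℝ) 1,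
        δ ≤ f (xiv (ratPoint p a) q b - s • xiv (ratPoint p a) p' a'))
    {x y : Fin n → ℝ} (hx : x = ratPoint p' a' - ratPoint p a) (hx0 : x ≠ 0) (hy0 : y ≠ 0)
    (hill : f (f y • x + (lam * f x) • y) < f x * f y)
    (hxδ : p * f x < δ / 2) (hyx : f y ≤ lam * f x)
    (hyp : (p + p') * f y < p * f x)
    {α : Fin n → ℝ} (hα : α = ratPoint p' a' + y) :
    ∀ (q : ℤ) (b : Fin n → ℤ), 1 ≤ q → q ≤ p' → (q, b) ≠ (p, a) → (q, b) ≠ (p', a') →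
      f (xiv α p a) < f (xiv α q b) := by
  have hpR : (1 : ℝ) ≤ p := by exact_mod_cast hp
  have hpR' : (1 : ℝ) ≤ p' := by exact_mod_cast hp'
  have hfx := hf.pos hx0
  have hfy := hf.pos hy0
  have hξ : xiv α p a = (p : ℝ) • (x + y) := by
    rw [xiv_eq_smul_sub hp, hα, hx]; congr 1; abel
  have hl : xiv (ratPoint p a) p' a' = -((p' : ℝ) • x) := by
    rw [xiv_eq_smul_sub hp', hx, ← smul_neg, neg_sub]
  have hfξ : f (xiv α p a) = p * f (x + y) := by rw [hξ, hf.smul _ (by linarith)]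
  have hlow := hf.le_add_add x y
  have hs : f (x + (lam * f x / f y) • y) < f x := by
    have e : f y • x + (lam * f x) • y = f y • (x + (lam * f x / f y) • y) := by
      rw [smul_add, smul_smul, mul_div_cancel₀ _ hfy.ne']
    rw [e, hf.smul _ hfy.le, mul_comm] at hill
    exact lt_of_mul_lt_mul_right hill hfy.le
  have hs1 : 1 ≤ lam * f x / f y := (one_le_div hfy).2 hyx
  have hxy : f (x + y) < f x := hf.add_lt_of_add_smul_lt hs1 hs
  have hfpos : 0 < f (x + y) := by nlinarith
  intro q b hq hqp hne hne'
  by_cases h0 : xiv (ratPoint p a) q b = 0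
  · obtain ⟨m, rfl, rfl⟩ := hprim.eq_smul hp h0
    have hm0 : 0 < m := by nlinarith
    have hm1 : m ≠ 1 := by rintro rfl; simp at hne
    have hm2 : (2 : ℝ) ≤ m := by exact_mod_cast (by omega : 2 ≤ m)
    rw [xiv_smul, hf.smul _ (by linarith), hfξ]
    have : 0 < p * f (x + y) := by positivity
    nlinarith
  by_cases h1 : xiv (ratPoint p a) q b = xiv (ratPoint p a) p' a'
  · have h2 : xiv (ratPoint p a) (p' + -1 * q) (a' + (-1 : ℤ) • b) = 0 := by
      rw [xiv_add, xiv_smul, h1]; simp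
    obtain ⟨m, hm, hma⟩ := hprim.eq_smul hp h2
    have hm0 : 0 ≤ m := by
      by_contra! h
      nlinarith
    have hmne : m ≠ 0 := by
      rintro rfl
      apply hne'
      have e1 : q = p' := by omega
      have e2 : b = a' := by
        have : a' - b = 0 := by simpa [sub_eq_add_neg] using hma
        exact (sub_eq_zero.1 this).symm
      rw [e1, e2]
    have hm1 : (1 : ℝ) ≤ m := by exact_mod_cast (by omega : 1 ≤ m)
    have hqR : (1 : ℝ) ≤ q := by exact_mod_cast hq
    have hqe : (q : ℝ) = p' - m * p := by
      have : q = p' - m * p := by linarith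
      exact_mod_cast this
    have hmp : 0 < (m : ℝ) * p := by positivity
    have e : xiv α q b = -(((m : ℝ) * p) • (x - (q / (m * p) : ℝ) • y)) := by
      rw [xiv_eq_add α (ratPoint p a), h1, hl, hα, smul_sub ((m : ℝ) * p), smul_smul,
        mul_div_cancel₀ _ hmp.ne']
      have : ratPoint p' a' + y - ratPoint p a = x + y := by rw [hx]; abel
      rw [this]
      ext j
      simp [hqe]
      ring
    rw [e, hf.neg, hf.smul _ hmp.le, hfξ]
    have h3 := hf.le_sub_smul_of_add_smul_lt (t := q / (m * p)) (by positivity)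
      (by positivity) hs
    calc p * f (x + y) < p * f x := by gcongr
      _ ≤ (m * p) * f x := by gcongr; nlinarith
      _ ≤ _ := by gcongr
  · have hqR : (1 : ℝ) ≤ q := by exact_mod_cast hq
    have hqR' : (q : ℝ) ≤ p' := by exact_mod_cast hqp
    have h2 := hgap q b h0 h1 (q / p') ⟨by positivity, (div_le_one (by linarith)).2 hqR'⟩
    have e : xiv (ratPoint p a) q b - (q / p' : ℝ) • xiv (ratPoint p a) p' a' + (q : ℝ) • y =
        xiv α q b := by
      have h3 : (q / p' : ℝ) • (p' : ℝ) • x = (q : ℝ) • x := by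
        rw [smul_smul, div_mul_cancel₀ _ (by linarith)]
      rw [hl, smul_neg, h3, xiv_eq_add α (ratPoint p a), hα, hx]
      module
    have h3 := hf.le_add_add
      (xiv (ratPoint p a) q b - (q / p' : ℝ) • xiv (ratPoint p a) p' a') ((q : ℝ) • y)
    rw [e, hf.smul _ (by linarith)] at h3
    rw [hfξ]
    nlinarith

lemma exists_next {f : (Fin n → ℝ) → ℝ} (hf : IsGaugeNorm f) {D D' : Set (Fin n → ℝ)}
    (hD : IsOpen D) (hcone : ∀ t : ℝ, 0 < t → ∀ x ∈ D, t • x ∈ D) (hne : D.Nonempty)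
    (h0 : 0 ∉ D) (h0' : 0 ∉ D') {lam : ℝ} (hlam : 0 < lam)
    (hill : ∀ x ∈ D, ∀ y ∈ D', f (f y • x + (lam * f x) • y) < f x * f y)
    (c : Fin (n + 1) → ℤ) {p : ℤ} {a : Fin n → ℤ} (hp : 1 ≤ p) (hprim : IsPrimitivePoint p a)
    {ε : ℝ} (hε : 0 < ε) :
    ∃ (p' : ℤ) (a' : Fin n → ℤ) (ε' : ℝ), 0 < ε' ∧ p < p' ∧ IsPrimitivePoint p' a' ∧
      (∀ α ∈ Metric.closedBall (ratPoint p' a') ε', α ∈ Metric.ball (ratPoint p a) ε ∧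
        α - ratPoint p a ∈ D ∧ (c ≠ 0 → affineForm c α ≠ 0)) ∧
      ∀ α ∈ Metric.ball (ratPoint p' a') ε', α - ratPoint p' a' ∈ D' →
        ∀ (q : ℤ) (b : Fin n → ℤ), 1 ≤ q → q ≤ p' → (q, b) ≠ (p, a) → (q, b) ≠ (p', a') →
          f (xiv α p a) < f (xiv α q b) := by
  have hpR : (1 : ℝ) ≤ p := by exact_mod_cast hp
  obtain ⟨D₁, hsub, hD₁, hcone₁, hne₁, hform⟩ : ∃ D₁ ⊆ D, IsOpen D₁ ∧
      (∀ t : ℝ, 0 < t → ∀ x ∈ D₁, t • x ∈ D₁) ∧ D₁.Nonempty ∧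
      ((fun j : Fin n => c j.succ) ≠ 0 →
        ∀ x ∈ D₁, ∑ j : Fin n, (c j.succ : ℝ) * x j ≠ 0) := by
    by_cases hc : (fun j : Fin n => c j.succ) = 0
    · exact ⟨D, subset_rfl, hD, hcone, hne, fun h => absurd hc h⟩
    · obtain ⟨D₁, h⟩ := exists_subcone_avoiding _ hc hD hcone hne
      exact ⟨D₁, h.1, h.2.1, h.2.2.1, h.2.2.2.1, fun _ => h.2.2.2.2⟩
  obtain ⟨q₀, b₀, hl, hlprim⟩ :=
    exists_primitive_remainder hp a hD₁ hcone₁ hne₁ fun h => h0 (hsub h)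
  set β := ratPoint p a with hβ
  set l := xiv β q₀ b₀ with hldef
  obtain ⟨δ, hδ, hgap⟩ := exists_gap hf hp a l hlprim
  have hline : Continuous fun s : ℝ => β + s • -l := by fun_prop
  have ev1 : ∀ᶠ s : ℝ in 𝓝[>] 0, β + s • -l ∈ Metric.ball β ε :=
    ((hline.tendsto' 0 β (by simp)).eventually (Metric.ball_mem_nhds β hε)).filter_mono
      nhdsWithin_le_nhds
  have ev2 : ∀ᶠ s : ℝ in 𝓝[>] 0, p * f (s • -l) < δ / 2 := by
    have : Continuous fun s : ℝ => p * f (s • -l) :=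
      continuous_const.mul (hf.continuous.comp (by fun_prop))
    exact ((this.tendsto' 0 0 (by simp [hf.map_zero])).eventually_lt_const
      (by positivity)).filter_mono nhdsWithin_le_nhds
  have ev3 : ∀ᶠ s : ℝ in 𝓝[>] 0, c ≠ 0 → affineForm c (β + s • -l) ≠ 0 := by
    by_cases hL : affineForm c β = 0
    · filter_upwards [self_mem_nhdsWithin] with s hs hc
      rw [affineForm_add_smul, hL, zero_add]
      refine mul_ne_zero (ne_of_gt hs) (hform (fun hc' => hc ?_) _ hl)
      have hcj : ∀ j : Fin n, c j.succ = 0 := fun j => congrFun hc' j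
      ext j
      refine Fin.cases ?_ hcj j
      simpa [affineForm, hcj] using hL
    · have := ((continuous_affineForm c).comp hline).continuousAt (x := 0)
      have h := this.eventually_ne (y := 0) (by simpa using hL)
      exact (h.filter_mono nhdsWithin_le_nhds).mono fun s hs _ => hs
  have htop : Tendsto (fun m : ℕ => ((q₀ + m * p : ℤ) : ℝ)) atTop atTop := by
    push_cast
    exact tendsto_atTop_add_const_left _ _
      (tendsto_natCast_atTop_atTop.atTop_mul_const (by linarith))
  have hinv := tendsto_inv_atTop_nhdsGT_zero.comp htop
  obtain ⟨m, ⟨⟨h1, h2⟩, h3⟩, h4⟩ :=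
    (((hinv.eventually ev1).and (hinv.eventually ev2)).and (hinv.eventually ev3)).and
      (htop.eventually (eventually_gt_atTop (p : ℝ))) |>.exists
  set p' : ℤ := q₀ + m * p with hp'def
  set a' : Fin n → ℤ := b₀ + (m : ℤ) • a with ha'def
  have hpp : p < p' := by exact_mod_cast h4
  have hp' : 1 ≤ p' := by omega
  have hpR' : (1 : ℝ) ≤ p' := by exact_mod_cast hp'
  have hl' : xiv β p' a' = l := by
    rw [hp'def, ha'def, xiv_add, xiv_smul, xiv_ratPoint_self hp]
    simp [hldef]
  have hβ' : ratPoint p' a' = β + (p' : ℝ)⁻¹ • -l := by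
    rw [← hl', xiv_eq_smul_sub hp', smul_neg, smul_smul, inv_mul_cancel₀ (by linarith)]
    simp
  simp only [Function.comp_apply] at h1 h2 h3
  rw [← hβ'] at h1 h3
  set x : Fin n → ℝ := ratPoint p' a' - β with hx
  have hxl : x = (p' : ℝ)⁻¹ • -l := by rw [hx, hβ']; simp
  rw [← hxl] at h2
  have hxD : x ∈ D := hsub (hxl ▸ hcone₁ _ (by positivity) _ hl)
  have hx0 : x ≠ 0 := fun h => h0 (h ▸ hxD)
  have hfx := hf.pos hx0
  have hprim' : IsPrimitivePoint p' a' := by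
    intro q b hqb
    rw [xiv_eq_add _ β, ← hx, hxl, smul_smul, smul_neg, add_neg_eq_zero] at hqb
    obtain ⟨k, hk⟩ := hlprim q b _ hqb
    refine ⟨k, ?_⟩
    have : (q : ℝ) = k * p' := by rw [← hk]; field_simp
    exact_mod_cast this
  have near : ∀ᶠ α in 𝓝 (ratPoint p' a'),
      (α ∈ Metric.ball β ε ∧ α - β ∈ D ∧ (c ≠ 0 → affineForm c α ≠ 0)) ∧
      (f (α - ratPoint p' a') ≤ lam * f x ∧
        (p + p') * f (α - ratPoint p' a') < p * f x) := by
    have hc1 : Continuous fun α : Fin n → ℝ => f (α - ratPoint p' a') :=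
      hf.continuous.comp (by fun_prop)
    have hc2 : Continuous fun α : Fin n → ℝ => (p + p') * f (α - ratPoint p' a') :=
      continuous_const.mul hc1
    refine Eventually.and (Eventually.and ?_ (Eventually.and ?_ ?_))
      (Eventually.and ?_ ?_)
    · exact Metric.isOpen_ball.mem_nhds h1
    · exact (hD.preimage (by fun_prop : Continuous fun α : Fin n → ℝ => α - β)).mem_nhds hxD
    · by_cases hc : c = 0
      · exact Eventually.of_forall fun _ h => absurd hc h
      · exact ((continuous_affineForm c).continuousAt.eventually_ne (h3 hc)).mono
          fun _ h _ => h
    · exact (hc1.tendsto' _ 0 (by simp [hf.map_zero])).eventually_le_const (by positivity)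
    · exact (hc2.tendsto' _ 0 (by simp [hf.map_zero])).eventually_lt_const (by positivity)
  obtain ⟨ε', hε', hball⟩ := Metric.nhds_basis_closedBall.eventually_iff.1 near
  refine ⟨p', a', ε', hε', hpp, hprim', fun α hα => (hball hα).1, fun α hα hαD => ?_⟩
  obtain ⟨hy1, hy2⟩ := (hball (Metric.ball_subset_closedBall hα)).2
  exact consecutive_of_gap hf hp hp' hprim hlam (by rw [hl']; exact hgap) hx hx0
    (fun h => h0' (h ▸ hαD)) (hill _ hxD _ hαD) h2 hy1 hy2 (by abel)

end Step

section DirectionCone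

variable {n : ℕ} {f : (Fin n → ℝ) → ℝ}

/-- The nonzero vectors whose direction is `δ`-close to `θ`. -/
def directionCone (f : (Fin n → ℝ) → ℝ) (θ : Fin n → ℝ) (δ : ℝ) : Set (Fin n → ℝ) :=
  {x | f (x - f x • θ) < δ * f x}

lemma isOpen_directionCone (hf : IsGaugeNorm f) (θ : Fin n → ℝ) (δ : ℝ) :
    IsOpen (directionCone f θ δ) := by
  have hc := hf.continuous
  exact isOpen_lt (hc.comp (by fun_prop)) (by fun_prop)

lemma smul_mem_directionCone (hf : IsGaugeNorm f) {θ : Fin n → ℝ} {δ t : ℝ} (ht : 0 < t)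
    {x : Fin n → ℝ} (hx : x ∈ directionCone f θ δ) : t • x ∈ directionCone f θ δ := by
  have hx : f (x - f x • θ) < δ * f x := hx
  change f (t • x - f (t • x) • θ) < δ * f (t • x)
  rw [hf.smul t ht.le, mul_smul, ← smul_sub, hf.smul t ht.le]
  calc t * f (x - f x • θ) < t * (δ * f x) := by gcongr
    _ = δ * (t * f x) := by ring

lemma self_mem_directionCone (hf : IsGaugeNorm f) {θ : Fin n → ℝ} (hθ : f θ = 1) {δ : ℝ}
    (hδ : 0 < δ) : θ ∈ directionCone f θ δ := by
  change f (θ - f θ • θ) < δ * f θ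
  simpa [hθ, hf.map_zero] using hδ

lemma zero_notMem_directionCone (hf : IsGaugeNorm f) (θ : Fin n → ℝ) (δ : ℝ) :
    0 ∉ directionCone f θ δ := fun h => by
  have h : f (0 - f 0 • θ) < δ * f 0 := h
  simp [hf.map_zero] at h

lemma map_normalize_sub_lt (hf : IsGaugeNorm f) {θ : Fin n → ℝ} {δ : ℝ} {x : Fin n → ℝ}
    (hx : x ∈ directionCone f θ δ) : f ((f x)⁻¹ • x - θ) < δ := by
  have hpos : 0 < f x := hf.pos fun h => zero_notMem_directionCone hf θ δ (h ▸ hx)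
  have hx : f (x - f x • θ) < δ * f x := hx
  have e : (f x)⁻¹ • x - θ = (f x)⁻¹ • (x - f x • θ) := by
    rw [smul_sub, smul_smul, inv_mul_cancel₀ hpos.ne', one_smul]
  rw [e, hf.smul _ (by positivity), inv_mul_lt_iff₀ hpos, mul_comm]
  exact hx

lemma illuminated_of_mem_directionCone (hf : IsGaugeNorm f) {θ θ' : Fin n → ℝ}
    {δ δ' lam : ℝ} (hlam : 0 < lam) (h : δ + lam * δ' ≤ 1 - f (θ + lam • θ'))
    {x y : Fin n → ℝ} (hx : x ∈ directionCone f θ δ) (hy : y ∈ directionCone f θ' δ') :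
    f (f y • x + (lam * f x) • y) < f x * f y := by
  have hfx : 0 < f x := hf.pos fun h => zero_notMem_directionCone hf θ δ (h ▸ hx)
  have hfy : 0 < f y := hf.pos fun h => zero_notMem_directionCone hf θ' δ' (h ▸ hy)
  have hx : f (x - f x • θ) < δ * f x := hx
  have hy : f (y - f y • θ') < δ' * f y := hy
  have e : f y • x + (lam * f x) • y = (f y • (x - f x • θ) +
      (lam * f x) • (y - f y • θ')) + (f x * f y) • (θ + lam • θ') := by
    module
  rw [e]
  calc _ ≤ (f (f y • (x - f x • θ)) + f ((lam * f x) • (y - f y • θ'))) +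
        f ((f x * f y) • (θ + lam • θ')) :=
        (hf.add_le _ _).trans (by gcongr; exact hf.add_le _ _)
    _ = f y * f (x - f x • θ) + (lam * f x) * f (y - f y • θ') +
        (f x * f y) * f (θ + lam • θ') := by
        rw [hf.smul _ hfy.le, hf.smul _ (by positivity), hf.smul _ (by positivity)]
    _ < f y * (δ * f x) + (lam * f x) * (δ' * f y) + (f x * f y) * f (θ + lam • θ') := by
        gcongr
    _ = (f x * f y) * (δ + lam * δ' + f (θ + lam • θ')) := by ring
    _ ≤ (f x * f y) * 1 := by gcongr; linarith
    _ = f x * f y := mul_one _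

end DirectionCone

lemma exists_antitone_pos_tendsto_zero (ρ : ℕ → ℝ) (hρ : ∀ k, 0 < ρ k) :
    ∃ δ : ℕ → ℝ, (∀ k, 0 < δ k) ∧ (∀ k, δ k ≤ ρ k) ∧ Antitone δ ∧
      Tendsto δ atTop (𝓝 0) := by
  let δ : ℕ → ℝ := fun k => Nat.rec (ρ 0) (fun k d => min (d / 2) (ρ (k + 1))) k
  have hsucc : ∀ k, δ (k + 1) = min (δ k / 2) (ρ (k + 1)) := fun k => rfl
  have hpos : ∀ k, 0 < δ k := by
    intro k
    induction k with
    | zero => exact hρ 0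
    | succ k ih => rw [hsucc]; exact lt_min (by positivity) (hρ _)
  have hhalf : ∀ k, δ (k + 1) ≤ δ k / 2 := fun k => hsucc k ▸ min_le_left _ _
  refine ⟨δ, hpos, ?_, antitone_nat_of_succ_le fun k => ?_, ?_⟩
  · rintro (_ | k)
    · exact le_rfl
    · exact hsucc k ▸ min_le_right _ _
  · linarith [hhalf k, hpos k]
  · have hle : ∀ k, δ k ≤ δ 0 * (1 / 2) ^ k := by
      intro k
      induction k with
      | zero => simp
      | succ k ih => rw [pow_succ]; linarith [hhalf k]
    refine squeeze_zero (fun k => (hpos k).le) hle ?_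
    simpa using (tendsto_pow_atTop_nhds_zero_of_lt_one (r := (1 / 2 : ℝ)) (by norm_num)
      (by norm_num)).const_mul (δ 0)

lemma limitPoints_subset_of_sub_tendsto_zero {n : ℕ} {u v : ℕ → Fin n → ℝ}
    (h : Tendsto (fun k => v k - u k) atTop (𝓝 0)) : LimitPoints u ⊆ LimitPoints v := by
  rintro x ⟨φ, hφ, hx⟩
  refine ⟨φ, hφ, ?_⟩
  have := hx.add (h.comp hφ.tendsto_atTop)
  rw [add_zero] at this
  exact this.congr fun k => by simp

lemma limitPoints_eq_of_sub_tendsto_zero {n : ℕ} {u v : ℕ → Fin n → ℝ}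
    (h : Tendsto (fun k => v k - u k) atTop (𝓝 0)) : LimitPoints v = LimitPoints u :=
  (limitPoints_subset_of_sub_tendsto_zero (by simpa using h.neg)).antisymm
    (limitPoints_subset_of_sub_tendsto_zero h)

/-- A sequence of integer points starting at denominator `1`, each one beating all integer
points up to the denominator of the next, is the only sequence of best approximations. -/
lemma eq_of_isFBSASeq {n : ℕ} {f : (Fin n → ℝ) → ℝ} {α : Fin n → ℝ} {p : ℕ → ℤ}
    {a : ℕ → Fin n → ℤ} (hp0 : p 0 = 1) (hp : ∀ k, p k < p (k + 1))
    (hbest : ∀ k q b, 1 ≤ q → q ≤ p (k + 1) → (q, b) ≠ (p k, a k) →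
      (q, b) ≠ (p (k + 1), a (k + 1)) → f (xiv α (p k) (a k)) < f (xiv α q b))
    {τ : ℕ → ℤ × (Fin n → ℤ)} (hτ : IsFBSASeq f α τ) : ∀ ν, τ ν = (p ν, a ν) := by
  obtain ⟨hτ1, hτ2, hτ3⟩ := hτ
  have hmono : StrictMono p := strictMono_nat_of_lt_succ hp
  have hp1 : ∀ k, 1 ≤ p k := fun k => hp0 ▸ hmono.monotone (Nat.zero_le k)
  have hfbsa : ∀ k, IsFBSA f α (p k) (a k) := by
    intro k
    refine ⟨hp1 k, fun q b hq hqp => ?_, fun b hb => ?_⟩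
    · refine hbest k q b hq (by linarith [hp k]) ?_ ?_
      · rintro h; have := congrArg Prod.fst h; dsimp at this; omega
      · rintro h; have := congrArg Prod.fst h; dsimp at this; have := hp k; omega
    · refine hbest k _ b (hp1 k) (hp k).le ?_ ?_
      · rintro h; exact hb (congrArg Prod.snd h)
      · rintro h; have := congrArg Prod.fst h; dsimp at this; have := hp k; omega
  have huniq : ∀ q b b', IsFBSA f α q b → IsFBSA f α q b' → b = b' := by
    intro q b b' h h'
    by_contra hne
    exact lt_asymm (h.2.2 b' (Ne.symm hne)) (h'.2.2 b hne)
  have hconv : ∀ q b, IsFBSA f α q b → ∃ k, q = p k := by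
    intro q b h
    by_contra! hne
    have hlt : ∀ k, p k < q := by
      intro k
      induction k with
      | zero => have := h.1; have := hne 0; omega
      | succ k ih =>
        by_contra! hle
        have h1 := h.2.1 (p k) (a k) (hp1 k) (by omega)
        refine lt_asymm h1 (hbest k q b h.1 hle ?_ ?_)
        · exact fun h => hne k (congrArg Prod.fst h)
        · exact fun h => hne (k + 1) (congrArg Prod.fst h)
    have hge : ∀ k : ℕ, (k : ℤ) < p k := by
      intro k
      induction k with
      | zero => simp [hp0]
      | succ k ih => have := hp k; push_cast; omega
    have := hlt q.toNat
    have := hge q.toNat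
    have := h.1
    omega
  have hfst : (fun ν => (τ ν).1) = p := by
    refine (StrictMono.range_inj (strictMono_nat_of_lt_succ hτ2) hmono).1 ?_
    ext q
    constructor
    · rintro ⟨ν, rfl⟩
      obtain ⟨k, hk⟩ := hconv _ _ (hτ1 ν)
      exact ⟨k, hk.symm⟩
    · rintro ⟨k, rfl⟩
      obtain ⟨ν, hν⟩ := hτ3 _ _ (hfbsa k)
      exact ⟨ν, congrArg Prod.fst hν⟩
  intro ν
  have h1 : (τ ν).1 = p ν := congrFun hfst ν
  exact Prod.ext h1 (huniq _ _ _ (h1 ▸ hτ1 ν) (hfbsa ν))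

/-- A vector whose best approximations have prescribed consecutive directions, up to `δ k`,
and which avoids countably many rational hyperplanes. -/
lemma exists_vector_with_directions {n : ℕ} {f : (Fin n → ℝ) → ℝ} (hf : IsGaugeNorm f)
    (D : ℕ → Set (Fin n → ℝ)) (hD : ∀ k, IsOpen (D k))
    (hcone : ∀ k, ∀ t : ℝ, 0 < t → ∀ x ∈ D k, t • x ∈ D k) (hne : ∀ k, (D k).Nonempty)
    (h0 : ∀ k, 0 ∉ D k) (lam : ℕ → ℝ) (hlam : ∀ k, 0 < lam k)
    (hill : ∀ k, ∀ x ∈ D k, ∀ y ∈ D (k + 1),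
      f (f y • x + (lam k * f x) • y) < f x * f y)
    (c : ℕ → Fin (n + 1) → ℤ) :
    ∃ α : Fin n → ℝ, (∀ k, c k ≠ 0 → affineForm (c k) α ≠ 0) ∧
      ∀ τ, IsFBSASeq f α τ → ∀ ν, xiv α (τ ν).1 (τ ν).2 ∈ D ν := by
  let State := {s : ℤ × (Fin n → ℤ) × ℝ // 1 ≤ s.1 ∧ IsPrimitivePoint s.1 s.2.1 ∧ 0 < s.2.2}
  let P (s : State) : ℤ := s.1.1
  let a (s : State) : Fin n → ℤ := s.1.2.1
  let ε (s : State) : ℝ := s.1.2.2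
  let pt (s : State) : Fin n → ℝ := ratPoint (P s) (a s)
  have hnext : ∀ (k : ℕ) (s : State), ∃ s' : State, P s < P s' ∧
      (∀ α ∈ Metric.closedBall (pt s') (ε s'), α ∈ Metric.ball (pt s) (ε s) ∧
        α - pt s ∈ D k ∧ (c k ≠ 0 → affineForm (c k) α ≠ 0)) ∧
      ∀ α ∈ Metric.ball (pt s') (ε s'), α - pt s' ∈ D (k + 1) →
        ∀ (q : ℤ) (b : Fin n → ℤ), 1 ≤ q → q ≤ P s' → (q, b) ≠ (P s, a s) →
          (q, b) ≠ (P s', a s') → f (xiv α (P s) (a s)) < f (xiv α q b) := by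
    rintro k ⟨⟨p, a, ε⟩, hp, hprim, hε⟩
    obtain ⟨p', a', ε', hε', hpp, hprim', h⟩ := exists_next hf (hD k) (hcone k) (hne k)
      (h0 k) (h0 (k + 1)) (hlam k) (hill k) (c k) hp hprim hε
    exact ⟨⟨⟨p', a', ε'⟩, by dsimp at hp ⊢; omega, hprim', hε'⟩, hpp, h⟩
  choose next hpp hball hcons using hnext
  let s : ℕ → State := fun k => Nat.rec
    ⟨⟨1, 0, 1⟩, le_rfl, fun q _ _ => ⟨q, (mul_one q).symm⟩, one_pos⟩ (fun k s => next k s) k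
  have hs : ∀ k, s (k + 1) = next k (s k) := fun _ => rfl
  obtain ⟨α, hα⟩ := IsCompact.nonempty_iInter_of_sequence_nonempty_isCompact_isClosed
    (fun k => Metric.closedBall (pt (s k)) (ε (s k)))
    (fun k α hα => Metric.ball_subset_closedBall (hball k (s k) α hα).1)
    (fun k => Metric.nonempty_closedBall.2 (s k).2.2.2.le)
    (isCompact_closedBall _ _) (fun k => Metric.isClosed_closedBall)
  have hα := fun k => hball k (s k) α (Set.mem_iInter.1 hα (k + 1))
  have hc := fun k => hcons k (s k) α (hα (k + 1)).1 (hα (k + 1)).2.1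
  refine ⟨α, fun k => (hα k).2.2, fun τ hτ ν => ?_⟩
  rw [eq_of_isFBSASeq (p := fun k => P (s k)) (a := fun k => a (s k)) rfl
    (fun k => hpp k (s k)) hc hτ ν]
  dsimp only
  rw [xiv_eq_smul_sub (s ν).2.1]
  have : 0 < P (s ν) := (s ν).2.1
  exact hcone ν _ (by exact_mod_cast this) _ (hα ν).2.1

/-- Every `f`-asymptotically admissible set `A ⊆ B_f^1` is the set of
asymptotic directions `Γ_f(α)` for some `α` with `1, α₁, …, α_n` linearly independent
over `ℚ`. -/
theorem stmt18 (n : ℕ) (f : (Fin n → ℝ) → ℝ) (hf : IsGaugeNorm f)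
    (A : Set (Fin n → ℝ)) (hA : A ⊆ {y : Fin n → ℝ | f y ≤ 1})
    (hadm : AsympAdmissible f A) :
    ∃ α : Fin n → ℝ,
      (∀ c : Fin (n + 1) → ℤ,
        ((c 0 : ℝ) + ∑ j : Fin n, (c j.succ : ℝ) * α j = 0) → c = 0) ∧
      ∀ τ : ℕ → ℤ × (Fin n → ℤ), IsFBSASeq f α τ →
        LimitPoints (Xiv f α τ) = A := by
  obtain ⟨θ, -, hθ, hlim⟩ := hadm
  choose hθ1 _ lam hlam hill using hθ
  have hill' : ∀ k, f (θ k + lam k • θ (k + 1)) < 1 := fun k => by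
    rw [← hf.neg, neg_add_rev]
    simpa [sub_eq_add_neg] using hill k
  obtain ⟨δ, hδ, hδρ, hanti, hδ0⟩ := exists_antitone_pos_tendsto_zero
    (fun k => (1 - f (θ k + lam k • θ (k + 1))) / (1 + lam k))
    fun k => div_pos (sub_pos.2 (hill' k)) (by linarith [hlam k])
  have hδlam : ∀ k, δ k + lam k * δ (k + 1) ≤ 1 - f (θ k + lam k • θ (k + 1)) := by
    intro k
    have h1 := hδρ k
    rw [le_div_iff₀ (by linarith [hlam k])] at h1
    have h2 := mul_le_mul_of_nonneg_left (hanti k.le_succ) (hlam k).le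
    simp only [Nat.succ_eq_add_one] at h2
    linarith
  obtain ⟨c, hc⟩ := exists_surjective_nat (Fin (n + 1) → ℤ)
  obtain ⟨α, hα, hτ⟩ := exists_vector_with_directions hf
    (fun k => directionCone f (θ k) (δ k)) (fun k => isOpen_directionCone hf _ _)
    (fun k t ht x hx => smul_mem_directionCone hf ht hx)
    (fun k => ⟨_, self_mem_directionCone hf (hθ1 k) (hδ k)⟩)
    (fun k => zero_notMem_directionCone hf _ _) lam hlam
    (fun k x hx y hy => illuminated_of_mem_directionCone hf (hlam k) (hδlam k) hx hy) c
  refine ⟨α, fun d hd => ?_, fun τ hτs => ?_⟩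
  · obtain ⟨k, rfl⟩ := hc d
    by_contra hne
    exact hα k hne hd
  · rw [← hlim]
    refine limitPoints_eq_of_sub_tendsto_zero ?_
    obtain ⟨κ, hκ, hκf⟩ := hf.exists_mul_norm_le
    refine squeeze_zero_norm (a := fun k => δ k / κ) (fun k => ?_) (by simpa using hδ0.div_const κ)
    rw [le_div_iff₀' hκ]
    exact (hκf _).trans (map_normalize_sub_lt hf (hτ τ hτs k)).le
end
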